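/- Let (W,S) be a Coxeter system and let I ⊆ S be a nonempty subset with at most three elements such that the elements of I pairwise commute and are pairwise conjugate in W. Suppose the standard parabolic subgroup W_I is the intersection of finitely many maximal finite subgroups of W. Then for every Coxeter system (W',S') and every group isomorphism f : W → W' there exists an element w ∈ W' such that f(I) ⊆ w S' w⁻¹; in particular, f(x) is a reflection of (W',S') for every x ∈ I. -/

import Mathlib

namespace CoxGeom

open CoxeterSystem

variable {B W : Type*} [Group W] {M : CoxeterMatrix B}

/-- Entries of the (normalised) Gram matrix of the geometric representation. -/
noncomputable def gram (M : CoxeterMatrix B) (s t : B) : ℝ := -2 * Real.cos (Real.pi / (M s t : ℝ))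

lemma gram_self (s : B) : gram M s s = 2 := by simp [gram]

lemma gram_symm (s t : B) : gram M s t = gram M t s := by
  simp only [gram, M.symmetric s t]

/-- Simple root. -/
noncomputable def al (s : B) : B →₀ ℝ := Finsupp.single s 1

/-- Simple coroot. -/
noncomputable def phi (M : CoxeterMatrix B) (s : B) : (B →₀ ℝ) →ₗ[ℝ] ℝ :=
  Finsupp.linearCombination ℝ (fun t => gram M s t)

lemma phi_al (s t : B) : phi M s (al t) = gram M s t := by
  simp [phi, al]

/-- Simple reflection. -/
noncomputable def refl (M : CoxeterMatrix B) (s : B) : Module.End ℝ (B →₀ ℝ) :=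
  LinearMap.id - (phi M s).smulRight (al s)

lemma refl_apply (s : B) (v : B →₀ ℝ) : refl M s v = v - phi M s v • al s := by
  simp [refl]

lemma refl_al_self (s : B) : refl M s (al s) = - al s := by
  rw [refl_apply, phi_al, gram_self]; module

lemma refl_refl (s : B) (v : B →₀ ℝ) : refl M s (refl M s v) = v := by
  rw [refl_apply, refl_apply, map_sub, map_smul, phi_al, gram_self]
  simp only [smul_eq_mul]; module

/-- Orbit vectors in the dihedral plane. -/
noncomputable def dvec (i j : B) (θ p : ℝ) : B →₀ ℝ :=
  Real.sin p • al i + Real.sin (p - θ) • al j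

lemma rot_dvec (i j : B) (p : ℝ) :
    refl M i (refl M j (dvec i j (Real.pi / (M i j : ℝ)) p)) =
      dvec i j (Real.pi / (M i j : ℝ)) (p + 2 * (Real.pi / (M i j : ℝ))) := by
  have h1 : gram M j i = -2 * Real.cos (Real.pi / (M i j : ℝ)) := by rw [gram_symm]; rfl
  have h2 : gram M i j = -2 * Real.cos (Real.pi / (M i j : ℝ)) := rfl
  set θ := Real.pi / (M i j : ℝ)
  have e1 : Real.sin (p + θ) = 2 * Real.cos θ * Real.sin p - Real.sin (p - θ) := by
    rw [Real.sin_add, Real.sin_sub]; ring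
  have e2 : Real.sin (p + 2 * θ) = 2 * Real.cos θ * Real.sin (p + θ) - Real.sin p := by
    have : p + 2 * θ = (p + θ) + θ := by ring
    have h3 : Real.sin p = Real.sin ((p + θ) - θ) := by congr 1; ring
    rw [this, Real.sin_add (p + θ), h3, Real.sin_sub (p + θ)]
    ring
  have e3 : p + 2 * θ - θ = p + θ := by ring
  simp only [dvec, refl_apply, map_add, map_sub, map_smul, phi_al, gram_self, h1, h2,
    smul_eq_mul, e3, e2, e1]
  module

lemma rot_pow_dvec (i j : B) (n : ℕ) (p : ℝ) :
    ((refl M i * refl M j) ^ n) (dvec i j (Real.pi / (M i j : ℝ)) p) =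
      dvec i j (Real.pi / (M i j : ℝ)) (p + n * (2 * (Real.pi / (M i j : ℝ)))) := by
  induction n generalizing p with
  | zero => simp
  | succ n ih =>
    rw [pow_succ, Module.End.mul_apply, Module.End.mul_apply, rot_dvec, ih]
    congr 1; push_cast; ring

lemma refl_liftable : M.IsLiftable (refl M) := by
  intro i j
  by_cases hij : i = j
  · subst hij
    refine LinearMap.ext fun v => ?_
    simp [refl_refl]
  by_cases hm : M i j = 0
  · simp [hm]
  have hm2 : 2 ≤ M i j := by
    have := M.off_diagonal i j hij
    omega
  have hmR : (2 : ℝ) ≤ (M i j : ℝ) := by exact_mod_cast hm2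
  have hsin : 0 < Real.sin (Real.pi / (M i j : ℝ)) := by
    apply Real.sin_pos_of_pos_of_lt_pi
    · have := Real.pi_pos; positivity
    · rw [div_lt_iff₀ (by linarith)]
      nlinarith [Real.pi_pos]
  have key : ∀ p, ((refl M i * refl M j) ^ (M i j)) (dvec i j (Real.pi / (M i j : ℝ)) p) =
      dvec i j (Real.pi / (M i j : ℝ)) p := by
    intro p
    rw [rot_pow_dvec]
    have : (M i j : ℝ) * (2 * (Real.pi / (M i j : ℝ))) = 2 * Real.pi := by field_simp
    rw [this]
    simp only [dvec, Real.sin_add_two_pi]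
    rw [show p + 2 * Real.pi - Real.pi / (M i j : ℝ) = p - Real.pi / (M i j : ℝ) + 2 * Real.pi by ring,
      Real.sin_add_two_pi]
  set θ := Real.pi / (M i j : ℝ) with hθ
  set R := (refl M i * refl M j) ^ (M i j) with hR
  have hi : R (al i) = al i := by
    have h := key θ
    simp only [dvec, sub_self, Real.sin_zero, zero_smul, add_zero, map_smul] at h
    exact smul_right_injective _ hsin.ne' h
  have hj : R (al j) = al j := by
    have h := key 0
    simp only [dvec, Real.sin_zero, zero_smul, zero_add, zero_sub, Real.sin_neg, map_smul] at h
    exact smul_right_injective _ (neg_ne_zero.2 hsin.ne') h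
  have hfix : ∀ z, phi M i z = 0 → phi M j z = 0 → R z = z := by
    intro z h1 h2
    rw [hR]
    have h3 : (refl M i * refl M j) z = z := by
      simp [refl_apply, h1, h2]
    generalize M i j = n
    induction n with
    | zero => simp
    | succ n ih => rw [pow_succ, Module.End.mul_apply, h3, ih]
  have h1 : gram M j i = -2 * Real.cos θ := by rw [gram_symm]; rfl
  have h2 : gram M i j = -2 * Real.cos θ := rfl
  refine LinearMap.ext fun v => ?_
  show R v = v
  have hd : Real.sin θ ^ 2 ≠ 0 := by positivity
  have hcs := Real.sin_sq_add_cos_sq θ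
  set a := (phi M i v + Real.cos θ * phi M j v) / (2 * Real.sin θ ^ 2) with ha
  set b := (phi M j v + Real.cos θ * phi M i v) / (2 * Real.sin θ ^ 2) with hb
  have hz := hfix (v - a • al i - b • al j) (by
    simp only [map_sub, map_smul, phi_al, gram_self, h2, smul_eq_mul, ha, hb]
    field_simp
    linear_combination phi M i v * hcs) (by
    simp only [map_sub, map_smul, phi_al, gram_self, h1, smul_eq_mul, ha, hb]
    field_simp
    linear_combination phi M j v * hcs)
  simp only [map_sub, map_smul, hi, hj] at hz
  simpa using hz

/-- Geometric representation. -/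
noncomputable def rep (cs : CoxeterSystem M W) : W →* Module.End ℝ (B →₀ ℝ) :=
  cs.lift ⟨refl M, refl_liftable⟩

variable (cs : CoxeterSystem M W)

lemma rep_simple (s : B) : rep cs (cs.simple s) = refl M s :=
  cs.lift_apply_simple _ _

lemma rep_mul_apply (u w : W) (v : B →₀ ℝ) : rep cs (u * w) v = rep cs u (rep cs w v) := by
  rw [map_mul]; rfl

lemma rep_one_apply (v : B →₀ ℝ) : rep cs 1 v = v := by
  rw [map_one]; rfl

lemma rep_inv_apply (w : W) (v : B →₀ ℝ) : rep cs w⁻¹ (rep cs w v) = v := by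
  rw [← rep_mul_apply, inv_mul_cancel, rep_one_apply]

lemma rep_apply_inv (w : W) (v : B →₀ ℝ) : rep cs w (rep cs w⁻¹ v) = v := by
  rw [← rep_mul_apply, mul_inv_cancel, rep_one_apply]

lemma rep_inj (w : W) : Function.Injective (rep cs w) := fun u v h => by
  rw [← rep_inv_apply cs w u, h, rep_inv_apply]

/-- nonnegative vectors -/
def Pos (v : B →₀ ℝ) : Prop := ∀ b, 0 ≤ v b

lemma pos_al (s : B) : Pos (al s) := by
  classical
  intro b; simp only [al, Finsupp.single_apply]; split_ifs <;> norm_num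

/-- generalized quantum integers -/
noncomputable def qn (c : ℝ) : ℕ → ℝ
  | 0 => 0
  | 1 => 1
  | (n + 2) => 2 * c * qn c (n + 1) - qn c n

lemma qn_sin (θ : ℝ) (n : ℕ) : qn (Real.cos θ) n * Real.sin θ = Real.sin (n * θ) := by
  induction n using Nat.twoStepInduction with
  | zero => simp [qn]
  | one => simp [qn]
  | more n h1 h2 =>
    rw [qn]
    have e1 : ((n + 2 : ℕ) : ℝ) * θ = ((n + 1 : ℕ) : ℝ) * θ + θ := by push_cast; ring
    have e2 : (n : ℝ) * θ = ((n + 1 : ℕ) : ℝ) * θ - θ := by push_cast; ring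
    rw [e1, sub_mul, h1, mul_assoc, h2, e2, Real.sin_add, Real.sin_sub]
    ring

lemma qn_one (n : ℕ) : qn 1 n = n := by
  induction n using Nat.twoStepInduction with
  | zero => simp [qn]
  | one => simp [qn]
  | more n h1 h2 => rw [qn, h1, h2]; push_cast; ring

lemma qn_nonneg {m n : ℕ} (hm : m = 0 ∨ (2 ≤ m ∧ n ≤ m)) :
    0 ≤ qn (Real.cos (Real.pi / (m : ℝ))) n := by
  rcases hm with rfl | ⟨h2, hn⟩
  · simp [qn_one]
  have hmR : (2 : ℝ) ≤ (m : ℝ) := by exact_mod_cast h2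
  have hnR : (n : ℝ) ≤ (m : ℝ) := by exact_mod_cast hn
  have hsin : 0 < Real.sin (Real.pi / (m : ℝ)) := by
    apply Real.sin_pos_of_pos_of_lt_pi
    · have := Real.pi_pos; positivity
    · rw [div_lt_iff₀ (by linarith)]
      nlinarith [Real.pi_pos]
  have h := qn_sin (Real.pi / (m : ℝ)) n
  have h3 : 0 ≤ Real.sin (n * (Real.pi / (m : ℝ))) := by
    apply Real.sin_nonneg_of_nonneg_of_le_pi
    · have := Real.pi_pos; positivity
    · rw [← mul_div_assoc, div_le_iff₀ (by linarith)]
      nlinarith [Real.pi_pos]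
  rw [← h] at h3
  exact nonneg_of_mul_nonneg_left h3 hsin

lemma rep_alt (s t : B) (n : ℕ) :
    rep cs (cs.wordProd (alternatingWord s t n)) (al s) =
      if Even n then
        qn (Real.cos (Real.pi / (M s t : ℝ))) (n + 1) • al s +
          qn (Real.cos (Real.pi / (M s t : ℝ))) n • al t
      else
        qn (Real.cos (Real.pi / (M s t : ℝ))) n • al s +
          qn (Real.cos (Real.pi / (M s t : ℝ))) (n + 1) • al t := by
  have h1 : gram M t s = -2 * Real.cos (Real.pi / (M s t : ℝ)) := by rw [gram_symm]; rfl
  have h2 : gram M s t = -2 * Real.cos (Real.pi / (M s t : ℝ)) := rfl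
  induction n with
  | zero => simp [alternatingWord, qn]
  | succ n ih =>
    rw [alternatingWord_succ', wordProd_cons, rep_mul_apply, ih]
    by_cases hn : Even n
    · have hn' : ¬ Even (n + 1) := by simpa [Nat.even_add_one] using hn
      simp only [hn, hn', if_true, if_false, rep_simple, refl_apply, map_add, map_smul, phi_al,
        gram_self, h1, smul_eq_mul, qn]
      module
    · have hn' : Even (n + 1) := by simpa [Nat.even_add_one] using hn
      simp only [hn, hn', if_true, if_false, rep_simple, refl_apply, map_add, map_smul, phi_al,
        gram_self, h2, smul_eq_mul, qn]
      module

lemma alt_prefix (s t : B) (m j : ℕ) :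
    ∃ l : List B, l.length = j ∧ alternatingWord s t (m + j) = l ++ alternatingWord s t m := by
  induction j with
  | zero => exact ⟨[], rfl, rfl⟩
  | succ j ih =>
    obtain ⟨l, hl, h⟩ := ih
    refine ⟨(if Even (m + j) then t else s) :: l, by simp [hl], ?_⟩
    rw [← add_assoc, alternatingWord_succ', h]; rfl

/-- Main positivity theorem. -/
theorem rep_pos (n : ℕ) : ∀ (w : W) (s : B), cs.length w = n →
    cs.length w < cs.length (w * cs.simple s) → Pos (rep cs w (al s)) := by
  classical
  induction n using Nat.strong_induction_on with
  | _ n IH =>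
  intro w s hw hs
  by_cases hw1 : w = 1
  · rw [hw1, rep_one_apply]; exact pos_al s
  obtain ⟨t, ht⟩ := cs.exists_rightDescent_of_ne_one hw1
  have hst : s ≠ t := by
    rintro rfl
    exact absurd hs (not_lt.2 (le_of_lt ht))
  let P : ℕ → Prop := fun k => ∃ v, w = v * cs.wordProd (alternatingWord s t k) ∧
    cs.length w = cs.length v + k
  have hP1 : P 1 := ⟨w * cs.simple t, by simp [alternatingWord], by
    have := cs.isRightDescent_iff.1 ht
    omega⟩
  have hbound : ∀ k, P k → k ≤ n := by
    rintro k ⟨v, -, h⟩; omega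
  have hn1 : 1 ≤ n := hbound 1 hP1
  set k := Nat.findGreatest P n with hk
  have hPk : P k := Nat.findGreatest_spec hn1 hP1
  have hk1 : 1 ≤ k := Nat.le_findGreatest hn1 hP1
  have hmax : ¬ P (k + 1) := by
    intro h
    have := Nat.le_findGreatest (hbound _ h) h
    omega
  obtain ⟨v, hv, hvl⟩ := hPk
  -- next letter
  have hnext : cs.length v < cs.length (v * cs.simple (if Even k then t else s)) := by
    by_contra hcon
    have hd : cs.IsRightDescent v (if Even k then t else s) :=
      lt_of_le_of_ne (not_lt.1 hcon) (cs.length_mul_simple_ne _ _)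
    rw [cs.isRightDescent_iff] at hd
    apply hmax
    refine ⟨v * cs.simple (if Even k then t else s), ?_, by omega⟩
    rw [alternatingWord_succ', wordProd_cons, ← mul_assoc, simple_mul_simple_cancel_right]
    exact hv
  have hprev : cs.length v < cs.length (v * cs.simple (if Even k then s else t)) := by
    by_contra hcon
    have hd : cs.IsRightDescent v (if Even k then s else t) :=
      lt_of_le_of_ne (not_lt.1 hcon) (cs.length_mul_simple_ne _ _)
    rw [cs.isRightDescent_iff] at hd
    obtain ⟨j, hj⟩ : ∃ j, k = j + 1 := ⟨k - 1, by omega⟩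
    have hpar : (if Even k then s else t) = (if Even j then t else s) := by
      rw [hj]; by_cases hje : Even j <;> simp [hje, Nat.even_add_one]
    have h1 : w = v * cs.simple (if Even k then s else t) *
        cs.wordProd (alternatingWord s t j) := by
      rw [hv, hj, alternatingWord_succ', wordProd_cons, ← hj, hpar, mul_assoc]
    have h2 := cs.length_mul_le (v * cs.simple (if Even k then s else t))
      (cs.wordProd (alternatingWord s t j))
    have h3 := cs.length_wordProd_le (alternatingWord s t j)
    rw [length_alternatingWord] at h3
    rw [← h1] at h2
    omega
  have hvs : cs.length v < cs.length (v * cs.simple s) ∧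
      cs.length v < cs.length (v * cs.simple t) := by
    by_cases hke : Even k
    · simp only [hke, if_true] at hnext hprev; exact ⟨hprev, hnext⟩
    · simp only [hke, if_false] at hnext hprev; exact ⟨hnext, hprev⟩
  have ps := IH (cs.length v) (by omega) v s rfl hvs.1
  have pt := IH (cs.length v) (by omega) v t rfl hvs.2
  have hkm : M s t = 0 ∨ (2 ≤ M s t ∧ k + 1 ≤ M s t) := by
    by_cases h0 : M s t = 0
    · exact Or.inl h0
    right
    have h1 := M.off_diagonal s t hst
    refine ⟨by omega, ?_⟩
    by_contra hcon
    obtain ⟨j, hj⟩ : ∃ j, k = M s t + j := ⟨k - M s t, by omega⟩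
    obtain ⟨l, hl, hal⟩ := alt_prefix s t (M s t) j
    obtain ⟨m', hm'⟩ : ∃ m', M s t = m' + 1 := ⟨M s t - 1, by omega⟩
    have hb := cs.wordProd_braidWord_eq s t
    have h2 : cs.wordProd (alternatingWord s t (M s t)) =
        cs.wordProd (alternatingWord s t m') * cs.simple s := by
      have : cs.wordProd (alternatingWord s t (M s t)) =
        cs.wordProd (alternatingWord t s (M s t)) := by
        rw [braidWord, braidWord, M.symmetric t s] at hb; exact hb
      rw [this, hm', alternatingWord_succ, wordProd_concat]
    have h3 : w * cs.simple s =
        v * (cs.wordProd l * cs.wordProd (alternatingWord s t m')) := by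
      rw [hv, hj, hal, wordProd_append, h2]
      simp only [mul_assoc, simple_mul_simple_self, mul_one]
    have h4 := cs.length_mul_le v (cs.wordProd l * cs.wordProd (alternatingWord s t m'))
    have h5 := cs.length_mul_le (cs.wordProd l) (cs.wordProd (alternatingWord s t m'))
    have h6 := cs.length_wordProd_le l
    have h7 := cs.length_wordProd_le (alternatingWord s t m')
    rw [length_alternatingWord] at h7
    rw [← h3] at h4
    omega
  have q1 : 0 ≤ qn (Real.cos (Real.pi / (M s t : ℝ))) k :=
    qn_nonneg (by omega)
  have q2 : 0 ≤ qn (Real.cos (Real.pi / (M s t : ℝ))) (k + 1) :=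
    qn_nonneg (by omega)
  intro b
  have hps := ps b
  have hpt := pt b
  rw [hv, rep_mul_apply, rep_alt]
  split_ifs <;>
  · simp only [map_add, map_smul, Finsupp.add_apply, Finsupp.smul_apply, smul_eq_mul]
    positivity

lemma rep_mul_simple_al (w : W) (s : B) :
    rep cs (w * cs.simple s) (al s) = - rep cs w (al s) := by
  rw [rep_mul_apply, rep_simple, refl_al_self, map_neg]

lemma rep_neg {w : W} {s : B} (h : cs.IsRightDescent w s) : Pos (- rep cs w (al s)) := by
  rw [← rep_mul_simple_al]
  apply rep_pos cs _ _ _ rfl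
  rw [simple_mul_simple_cancel_right]
  exact h

lemma rep_pos_or_neg (w : W) (s : B) : Pos (rep cs w (al s)) ∨ Pos (- rep cs w (al s)) := by
  by_cases h : cs.IsRightDescent w s
  · exact Or.inr (rep_neg cs h)
  · left
    apply rep_pos cs _ _ _ rfl
    rw [cs.not_isRightDescent_iff] at h
    omega

/-- Invariant form. -/
noncomputable def form (M : CoxeterMatrix B) : (B →₀ ℝ) →ₗ[ℝ] (B →₀ ℝ) →ₗ[ℝ] ℝ :=
  Finsupp.linearCombination ℝ (fun s => phi M s)

lemma form_al (s : B) : form M (al s) = phi M s := by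
  simp [form, al]

lemma form_symm (u v : B →₀ ℝ) : form M u v = form M v u := by
  have h : form M = (form M).flip := by
    refine Finsupp.lhom_ext' fun s => LinearMap.ext_ring ?_
    refine Finsupp.lhom_ext' fun t => LinearMap.ext_ring ?_
    change form M (al s) (al t) = form M (al t) (al s)
    rw [form_al, form_al, phi_al, phi_al, gram_symm]
  conv_lhs => rw [h]
  rfl

lemma form_refl (s : B) (u v : B →₀ ℝ) : form M (refl M s u) (refl M s v) = form M u v := by
  have h : form M u (al s) = phi M s u := by rw [form_symm, form_al]
  simp only [refl_apply, map_sub, map_smul, LinearMap.sub_apply, LinearMap.smul_apply, form_al,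
    phi_al, gram_self, h, smul_eq_mul]
  ring

lemma form_rep (w : W) (u v : B →₀ ℝ) : form M (rep cs w u) (rep cs w v) = form M u v := by
  induction w using cs.simple_induction_left with
  | one => simp [rep_one_apply]
  | mul_simple_left w i ih => rw [rep_mul_apply, rep_mul_apply, rep_simple, form_refl, ih]

/-- Roots. -/
def Root (v : B →₀ ℝ) : Prop := ∃ (w : W) (s : B), v = rep cs w (al s)

lemma root_al (s : B) : Root cs (al s) := ⟨1, s, by rw [rep_one_apply]⟩

variable {cs}

lemma Root.rep {v : B →₀ ℝ} (h : Root cs v) (w : W) : Root cs (rep cs w v) := by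
  obtain ⟨u, s, rfl⟩ := h
  exact ⟨w * u, s, by rw [rep_mul_apply]⟩

lemma Root.neg {v : B →₀ ℝ} (h : Root cs v) : Root cs (-v) := by
  obtain ⟨u, s, rfl⟩ := h
  exact ⟨u * cs.simple s, s, by rw [rep_mul_simple_al]⟩

lemma Root.form {v : B →₀ ℝ} (h : Root cs v) : form M v v = 2 := by
  obtain ⟨u, s, rfl⟩ := h
  rw [form_rep, form_al, phi_al, gram_self]

lemma Root.ne_zero {v : B →₀ ℝ} (h : Root cs v) : v ≠ 0 := by
  rintro rfl
  have := h.form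
  simp at this

lemma Root.pos_or_neg {v : B →₀ ℝ} (h : Root cs v) : Pos v ∨ Pos (-v) := by
  obtain ⟨u, s, rfl⟩ := h
  exact rep_pos_or_neg cs u s

lemma Root.not_both {v : B →₀ ℝ} (h : Root cs v) (h1 : Pos v) (h2 : Pos (-v)) : False := by
  apply h.ne_zero
  ext b
  have := h1 b
  have := h2 b
  simp only [Finsupp.neg_apply, Finsupp.zero_apply] at *
  linarith

lemma refl_pos {v : B →₀ ℝ} (h : Root cs v) (hp : Pos v) {s : B} (hs : v ≠ al s) :
    Pos (refl M s v) := by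
  have hr : Root cs (refl M s v) := by rw [← rep_simple cs]; exact h.rep _
  rcases hr.pos_or_neg with h1 | h1
  · exact h1
  exfalso
  have hz : ∀ b, b ≠ s → v b = 0 := by
    intro b hb
    have h2 := h1 b
    have h3 := hp b
    simp only [refl_apply, al, Finsupp.neg_apply, Finsupp.sub_apply, Finsupp.smul_apply,
      Finsupp.single_eq_of_ne hb, smul_eq_mul, mul_zero, sub_zero] at h2
    linarith
  have hv : v = v s • al s := by
    ext b
    by_cases hb : b = s
    · subst hb; simp [al]
    · simp [hz b hb, al, Finsupp.single_eq_of_ne hb]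
  have hf := h.form
  rw [hv] at hf
  simp only [map_smul, LinearMap.smul_apply, form_al, phi_al, gram_self, smul_eq_mul] at hf
  have h1s : v s = 1 := by
    have := hp s
    nlinarith
  apply hs
  rw [hv, h1s, one_smul]

variable (cs)

lemma inv_finite (w : W) : {v | Root cs v ∧ Pos v ∧ Pos (-(rep cs w v))}.Finite := by
  induction w using cs.simple_induction_left with
  | one =>
    convert Set.finite_empty
    ext v
    simp only [Set.mem_setOf_eq, Set.mem_empty_iff_false, iff_false, rep_one_apply]
    rintro ⟨h1, h2, h3⟩
    exact h1.not_both h2 h3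
  | mul_simple_left w s ih =>
    refine (ih.union (Set.finite_singleton (rep cs w⁻¹ (al s)))).subset ?_
    rintro v ⟨h1, h2, h3⟩
    rcases (h1.rep w).pos_or_neg with h4 | h4
    · right
      by_contra hne
      rw [rep_mul_apply, rep_simple] at h3
      have h5 : rep cs w v ≠ al s := by
        intro h
        apply hne
        rw [Set.mem_singleton_iff, ← h, rep_inv_apply]
      have hr : Root cs (refl M s (rep cs w v)) := by
        rw [← rep_simple cs]; exact (h1.rep w).rep _
      exact hr.not_both (refl_pos (h1.rep w) h4 h5) h3
    · left; exact ⟨h1, h2, h4⟩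

/-- Points of the (interior of the) Tits cone. -/
def Inner (x : (B →₀ ℝ) →ₗ[ℝ] ℝ) : Prop := {v | Root cs v ∧ Pos v ∧ x v ≤ 0}.Finite

/-- Stabilizer of a point. -/
def Stab (x : (B →₀ ℝ) →ₗ[ℝ] ℝ) : Subgroup W where
  carrier := {w | ∀ v, x (rep cs w v) = x v}
  one_mem' := fun v => by rw [rep_one_apply]
  mul_mem' := fun {a b} ha hb v => by rw [rep_mul_apply, ha, hb]
  inv_mem' := fun {a} ha v => by
    have := ha (rep cs a⁻¹ v)
    rw [rep_apply_inv] at this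
    exact this.symm

variable {cs}

lemma mem_Stab {x : (B →₀ ℝ) →ₗ[ℝ] ℝ} {w : W} :
    w ∈ Stab cs x ↔ ∀ v, x (rep cs w v) = x v := Iff.rfl

lemma simple_mem_Stab {x : (B →₀ ℝ) →ₗ[ℝ] ℝ} {s : B} (h : x (al s) = 0) :
    cs.simple s ∈ Stab cs x := by
  intro v
  rw [rep_simple, refl_apply, map_sub, map_smul, h, smul_zero, sub_zero]

lemma mem_Stab_comp {x : (B →₀ ℝ) →ₗ[ℝ] ℝ} {u w : W} :
    u ∈ Stab cs (x ∘ₗ rep cs w) ↔ w * u * w⁻¹ ∈ Stab cs x := by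
  simp only [mem_Stab, LinearMap.comp_apply]
  constructor
  · intro h v
    have := h (rep cs w⁻¹ v)
    rw [rep_apply_inv] at this
    rw [rep_mul_apply, rep_mul_apply, this]
  · intro h v
    have := h (rep cs w v)
    rw [rep_mul_apply, rep_mul_apply, rep_inv_apply] at this
    exact this

lemma Inner.comp {x : (B →₀ ℝ) →ₗ[ℝ] ℝ} (hx : Inner cs x) (w : W) :
    Inner cs (x ∘ₗ rep cs w) := by
  have h1 := hx.preimage (f := rep cs w) ((rep_inj cs w).injOn)
  refine ((inv_finite cs w).union h1).subset ?_
  rintro v ⟨a, b, c⟩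
  rcases (a.rep w).pos_or_neg with h | h
  · right; exact ⟨a.rep w, h, c⟩
  · left; exact ⟨a, b, h⟩

lemma exists_dominant (n : ℕ) : ∀ x : (B →₀ ℝ) →ₗ[ℝ] ℝ, Inner cs x →
    {v | Root cs v ∧ Pos v ∧ x v < 0}.ncard = n →
    ∃ w : W, ∀ s, 0 ≤ x (rep cs w (al s)) := by
  induction n using Nat.strong_induction_on with
  | _ n IH =>
  intro x hx hn
  by_cases hd : ∀ s, 0 ≤ x (al s)
  · exact ⟨1, fun s => by rw [rep_one_apply]; exact hd s⟩
  push Not at hd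
  obtain ⟨s, hs⟩ := hd
  have hfin : {v | Root cs v ∧ Pos v ∧ x v < 0}.Finite :=
    Set.Finite.subset hx fun v hv => ⟨hv.1, hv.2.1, hv.2.2.le⟩
  have hlt : {v | Root cs v ∧ Pos v ∧ (x ∘ₗ rep cs (cs.simple s)) v < 0}.ncard < n := by
    rw [← hn, ← Set.ncard_image_of_injective _ (rep_inj cs (cs.simple s))]
    apply Set.ncard_lt_ncard _ hfin
    rw [Set.ssubset_iff_of_subset]
    · refine ⟨al s, ⟨root_al cs s, pos_al s, hs⟩, ?_⟩
      rintro ⟨v, ⟨h1, h2, h3⟩, h4⟩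
      have : v = - al s := by
        apply rep_inj cs (cs.simple s)
        rw [h4, rep_simple, map_neg, refl_al_self, neg_neg]
      rw [this] at h2
      exact (root_al cs s).not_both (pos_al s) h2
    · rintro _ ⟨v, ⟨h1, h2, h3⟩, rfl⟩
      refine ⟨h1.rep _, ?_, h3⟩
      rw [rep_simple]
      apply refl_pos h1 h2
      rintro rfl
      simp only [LinearMap.comp_apply, rep_simple, refl_al_self, map_neg] at h3
      linarith
  obtain ⟨w, hw⟩ := IH _ hlt _ (hx.comp _) rfl
  exact ⟨cs.simple s * w, fun t => by rw [rep_mul_apply]; exact hw t⟩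

lemma descent_zero {x : (B →₀ ℝ) →ₗ[ℝ] ℝ} (hx : ∀ s, 0 ≤ x (al s)) {w : W}
    (hw : w ∈ Stab cs x) {s : B} (hs : cs.IsRightDescent w s) : x (al s) = 0 := by
  have hpos : ∀ v, Pos v → 0 ≤ x v := by
    intro v hv
    rw [← Finsupp.sum_single v, Finsupp.sum, map_sum]
    apply Finset.sum_nonneg
    intro b _
    have : Finsupp.single b (v b) = v b • al b := by simp [al]
    rw [this, map_smul]
    exact mul_nonneg (hv b) (hx b)
  have h1 := hpos _ (rep_neg cs hs)
  rw [map_neg, hw] at h1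
  have := hx s
  linarith

lemma Stab_eq {x : (B →₀ ℝ) →ₗ[ℝ] ℝ} (hx : ∀ s, 0 ≤ x (al s)) :
    Stab cs x = Subgroup.closure (cs.simple '' {s | x (al s) = 0}) := by
  apply le_antisymm
  · intro w hw
    obtain ⟨n, hn⟩ : ∃ n, cs.length w = n := ⟨_, rfl⟩
    induction n using Nat.strong_induction_on generalizing w with
    | _ n IH =>
    by_cases h1 : w = 1
    · rw [h1]; exact one_mem _
    obtain ⟨s, hs⟩ := cs.exists_rightDescent_of_ne_one h1
    have h0 := descent_zero hx hw hs
    have h2 : cs.simple s ∈ Subgroup.closure (cs.simple '' {s | x (al s) = 0}) :=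
      Subgroup.subset_closure ⟨s, h0, rfl⟩
    have h3 := IH _ (hn ▸ hs) (mul_mem hw (simple_mem_Stab h0)) rfl
    have := mul_mem h3 h2
    rwa [cs.simple_mul_simple_cancel_right] at this
  · rw [Subgroup.closure_le]
    rintro _ ⟨s, hs, rfl⟩
    exact simple_mem_Stab hs

lemma Stab_finite_of_dominant {x : (B →₀ ℝ) →ₗ[ℝ] ℝ} (hx : Inner cs x)
    (hd : ∀ s, 0 ≤ x (al s)) : Finite (Stab cs x) := by
  set F := {v | Root cs v ∧ Pos v ∧ x v = 0} with hF
  have hFf : F.Finite := Set.Finite.subset hx fun v hv => ⟨hv.1, hv.2.1, hv.2.2.le⟩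
  have hG : (F ∪ (fun v => -v) '' F).Finite := hFf.union (hFf.image _)
  have := hFf.to_subtype
  have := hG.to_subtype
  let g : Stab cs x → (F → (F ∪ (fun v => -v) '' F : Set (B →₀ ℝ))) := fun w v =>
    ⟨rep cs w v, by
      obtain ⟨w, hw⟩ := w
      obtain ⟨v, h1, h2, h3⟩ := v
      have h4 := hw v
      rw [h3] at h4
      rcases (h1.rep w).pos_or_neg with h | h
      · left; exact ⟨h1.rep w, h, h4⟩
      · right; exact ⟨_, ⟨(h1.rep w).neg, h, by rw [map_neg, h4, neg_zero]⟩, neg_neg _⟩⟩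
  apply Finite.of_injective g
  rintro ⟨u, hu⟩ ⟨w, hw⟩ huw
  rw [Subtype.mk_eq_mk]
  by_contra hne
  have hne1 : u⁻¹ * w ≠ 1 := by
    intro h
    exact hne (inv_mul_eq_one.1 h)
  obtain ⟨s, hs⟩ := cs.exists_rightDescent_of_ne_one hne1
  have h0 := descent_zero hd (mul_mem (inv_mem hu) hw) hs
  have h1 := congrArg Subtype.val (congrFun huw ⟨al s, root_al cs s, pos_al s, h0⟩)
  simp only [g] at h1
  have h2 := rep_neg cs hs
  rw [rep_mul_apply, ← h1, rep_inv_apply] at h2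
  exact (root_al cs s).not_both (pos_al s) h2

lemma Stab_finite {x : (B →₀ ℝ) →ₗ[ℝ] ℝ} (hx : Inner cs x) : Finite (Stab cs x) := by
  obtain ⟨w, hw⟩ := exists_dominant _ x hx rfl
  have := Stab_finite_of_dominant (hx.comp w) hw
  refine Finite.of_injective (β := Stab cs (x ∘ₗ rep cs w))
    (fun u => ⟨w⁻¹ * u * w, by rw [mem_Stab_comp]; convert u.2 using 1; group⟩) ?_
  intro a b h
  simpa using h

/-- Every finite subgroup fixes an inner point. -/
lemma exists_fixed (H : Subgroup W) [Finite H] : ∃ x, Inner cs x ∧ H ≤ Stab cs x := by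
  classical
  have := Fintype.ofFinite H
  set ρ : (B →₀ ℝ) →ₗ[ℝ] ℝ := Finsupp.linearCombination ℝ (fun _ : B => (1 : ℝ)) with hρ
  have hpos : ∀ v, Root cs v → Pos v → 0 < ρ v := by
    intro v h1 h2
    have h3 : ∃ b, v b ≠ 0 := by
      by_contra hcon
      push Not at hcon
      exact h1.ne_zero (Finsupp.ext hcon)
    obtain ⟨b, hb⟩ := h3
    rw [hρ, Finsupp.linearCombination_apply, Finsupp.sum]
    simp only [smul_eq_mul, mul_one]
    exact Finset.sum_pos' (fun i _ => h2 i)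
      ⟨b, Finsupp.mem_support_iff.2 hb, lt_of_le_of_ne (h2 b) (Ne.symm hb)⟩
  refine ⟨∑ h : H, ρ ∘ₗ rep cs (h : W), ?_, ?_⟩
  · refine (Set.finite_iUnion fun h : H => inv_finite cs (h : W)).subset ?_
    rintro v ⟨h1, h2, h3⟩
    by_contra hcon
    simp only [Set.mem_iUnion, not_exists] at hcon
    rw [LinearMap.sum_apply] at h3
    have : 0 < ∑ h : H, (ρ ∘ₗ rep cs (h : W)) v := by
      apply Finset.sum_pos _ ⟨1, Finset.mem_univ _⟩
      intro h _
      apply hpos _ (h1.rep _)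
      rcases (h1.rep (h : W)).pos_or_neg with h4 | h4
      · exact h4
      · exact absurd ⟨h1, h2, h4⟩ (hcon h)
    linarith
  · intro u hu v
    simp only [LinearMap.sum_apply, LinearMap.comp_apply, ← rep_mul_apply]
    exact Fintype.sum_equiv (Equiv.mulRight (⟨u, hu⟩ : H)) _ _ (fun h => rfl)

lemma inter_inner {x y : (B →₀ ℝ) →ₗ[ℝ] ℝ} (hx : Inner cs x) (hy : Inner cs y) :
    ∃ z, Inner cs z ∧ Stab cs z = Stab cs x ⊓ Stab cs y := by
  have hF := hx.union hy
  set F := {v | Root cs v ∧ Pos v ∧ x v ≤ 0} ∪ {v | Root cs v ∧ Pos v ∧ y v ≤ 0} with hFd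
  obtain ⟨c, hc0, hc⟩ : ∃ c : ℝ, 0 < c ∧ c ∉ (fun v => - x v / y v) '' F := by
    have := (Set.Ioi_infinite (0 : ℝ)).diff (hF.image (fun v => - x v / y v))
    obtain ⟨c, h1, h2⟩ := this.nonempty
    exact ⟨c, h1, h2⟩
  have hmem : ∀ v, Root cs v → Pos v → (x + c • y) v ≤ 0 → v ∈ F := by
    intro v h1 h2 h3
    by_contra hcon
    simp only [hFd, Set.mem_union, Set.mem_setOf_eq, h1, h2, true_and, not_or, not_le] at hcon
    simp only [LinearMap.add_apply, LinearMap.smul_apply, smul_eq_mul] at h3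
    nlinarith [mul_pos hc0 hcon.2]
  have hzero : ∀ v, Root cs v → (x + c • y) v = 0 → x v = 0 ∧ y v = 0 := by
    have main : ∀ v, Root cs v → Pos v → (x + c • y) v = 0 → x v = 0 ∧ y v = 0 := by
      intro v h1 h2 h3
      have h4 := hmem v h1 h2 h3.le
      simp only [LinearMap.add_apply, LinearMap.smul_apply, smul_eq_mul] at h3
      have hy0 : y v = 0 := by
        by_contra hne
        apply hc
        refine ⟨v, h4, ?_⟩
        simp only
        rw [div_eq_iff hne]
        linarith
      rw [hy0] at h3
      exact ⟨by linarith, hy0⟩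
    intro v h1 h2
    rcases h1.pos_or_neg with h | h
    · exact main v h1 h h2
    · have := main (-v) h1.neg h (by rw [map_neg, h2, neg_zero])
      simpa using this
  have hz : Inner cs (x + c • y) := hF.subset fun v hv => hmem v hv.1 hv.2.1 hv.2.2
  refine ⟨x + c • y, hz, le_antisymm ?_ ?_⟩
  · obtain ⟨w, hw⟩ := exists_dominant _ _ hz rfl
    have h1 := Stab_eq (cs := cs) (x := (x + c • y) ∘ₗ rep cs w) hw
    have h2 : Stab cs ((x + c • y) ∘ₗ rep cs w) ≤
        Stab cs (x ∘ₗ rep cs w) ⊓ Stab cs (y ∘ₗ rep cs w) := by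
      rw [h1, Subgroup.closure_le]
      rintro _ ⟨s, hs, rfl⟩
      have := hzero _ ((root_al cs s).rep w) hs
      exact ⟨simple_mem_Stab this.1, simple_mem_Stab this.2⟩
    intro u hu
    have e : w * (w⁻¹ * u * w) * w⁻¹ = u := by group
    have h3 := @h2 (w⁻¹ * u * w) (by rw [mem_Stab_comp, e]; exact hu)
    rw [Subgroup.mem_inf, mem_Stab_comp, mem_Stab_comp, e] at h3
    exact h3
  · rintro u ⟨h1, h2⟩ v
    simp only [LinearMap.add_apply, LinearMap.smul_apply]
    rw [h1, h2]

lemma exists_inner_of_iInf {n : ℕ} (hn : 0 < n) (Hs : Fin n → Subgroup W)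
    (h : ∀ i, Finite ↥(Hs i) ∧ ∀ K : Subgroup W, Finite ↥K → Hs i ≤ K → K = Hs i) :
    ∃ x, Inner cs x ∧ Stab cs x = ⨅ i, Hs i := by
  have h1 : ∀ i, ∃ x, Inner cs x ∧ Stab cs x = Hs i := by
    intro i
    have := (h i).1
    obtain ⟨x, hx, hle⟩ := exists_fixed (cs := cs) (Hs i)
    exact ⟨x, hx, (h i).2 _ (Stab_finite hx) hle⟩
  have h2 : ∀ s : Finset (Fin n), s.Nonempty → ∃ x, Inner cs x ∧ Stab cs x = ⨅ i ∈ s, Hs i := by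
    intro s hs
    induction hs using Finset.Nonempty.cons_induction with
    | singleton a => simpa using h1 a
    | cons a s ha hs ih =>
      obtain ⟨x, hx, hx'⟩ := ih
      obtain ⟨y, hy, hy'⟩ := h1 a
      obtain ⟨z, hz, hz'⟩ := inter_inner hy hx
      refine ⟨z, hz, ?_⟩
      rw [hz', hx', hy']
      classical
      rw [Finset.cons_eq_insert, Finset.iInf_insert]
  have := h2 Finset.univ ⟨⟨0, hn⟩, Finset.mem_univ _⟩
  simpa using this

lemma al_ne_neg (s : B) : al s ≠ - al s := by
  intro h
  have := DFunLike.congr_fun h s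
  simp only [al, Finsupp.single_eq_same, Finsupp.neg_apply] at this
  norm_num at this

lemma gram_zero_of_comm {a b : B} (hab : a ≠ b)
    (h : cs.simple a * cs.simple b = cs.simple b * cs.simple a) : gram M a b = 0 := by
  have h1 : rep cs (cs.simple a * cs.simple b) (al a) =
    rep cs (cs.simple b * cs.simple a) (al a) := by rw [h]
  rw [rep_mul_apply, rep_mul_apply, rep_simple, rep_simple, refl_al_self] at h1
  have h2 := DFunLike.congr_fun h1 b
  simp only [refl_apply, map_sub, map_neg, map_smul, phi_al, gram_self] at h2
  simp only [al, Finsupp.sub_apply, Finsupp.neg_apply, Finsupp.smul_apply, Finsupp.single_eq_same,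
    Finsupp.single_eq_of_ne hab.symm, smul_eq_mul] at h2
  rw [gram_symm b a] at h2
  linarith

lemma not_conj {g : W} {s a b : B} (hab : a ≠ b) (hg : IsConj (cs.simple s) g)
    (ha : rep cs g (al a) = - al a) (hb : rep cs g (al b) = - al b) : False := by
  obtain ⟨c, hc⟩ := isConj_iff.1 hg
  have key : ∀ v, rep cs g v = - v → ∃ r : ℝ, v = r • rep cs c (al s) := by
    intro v hv
    refine ⟨phi M s (rep cs c⁻¹ v) / 2, ?_⟩
    rw [← map_smul]
    apply rep_inj cs c⁻¹
    have h1 : rep cs c⁻¹ (rep cs g v) = - rep cs c⁻¹ v := by rw [hv, map_neg]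
    rw [← hc, rep_mul_apply, rep_mul_apply, rep_inv_apply, rep_simple, refl_apply] at h1
    have h2 : (2 : ℝ) • rep cs c⁻¹ v = phi M s (rep cs c⁻¹ v) • al s := by
      rw [two_smul]
      have := sub_eq_iff_eq_add.1 h1
      nth_rewrite 2 [this]
      abel
    apply smul_right_injective _ (two_ne_zero (α := ℝ))
    simp only
    rw [h2, rep_inv_apply, smul_smul]
    congr 1
    ring
  obtain ⟨r, hr⟩ := key _ ha
  obtain ⟨r', hr'⟩ := key _ hb
  have e1 := DFunLike.congr_fun hr a
  have e2 := DFunLike.congr_fun hr b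
  have e3 := DFunLike.congr_fun hr' b
  simp only [al, Finsupp.single_eq_same, Finsupp.single_eq_of_ne hab.symm,
    Finsupp.smul_apply, smul_eq_mul] at e1 e2 e3
  rcases mul_eq_zero.1 e2.symm with h | h
  · rw [h] at e1; simp at e1
  · rw [h] at e3; simp at e3

open Classical in
/-- sign vectors -/
noncomputable def dv (cs : CoxeterSystem M W) (x : (B →₀ ℝ) →ₗ[ℝ] ℝ) (u : W) : B → ZMod 2 :=
  fun j => if x (al j) = 0 ∧ rep cs u (al j) = - al j then 1 else 0

theorem core {B₀ : Type*} (x : (B →₀ ℝ) →ₗ[ℝ] ℝ) (hx : ∀ s, 0 ≤ x (al s)) (I : Finset B₀)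
    (hne : I.Nonempty) (hcard : I.card ≤ 3) (g : B₀ → W)
    (hcomm : ∀ i ∈ I, ∀ j ∈ I, g i * g j = g j * g i)
    (hone : ∀ i ∈ I, g i ≠ 1)
    (hconj : ∀ i ∈ I, ∀ j ∈ I, IsConj (g i) (g j))
    (hcl : Subgroup.closure (g '' I) = Stab cs x) :
    ∀ i ∈ I, ∃ b, g i = cs.simple b := by
  classical
  have hSt := Stab_eq (cs := cs) hx
  have hgS : ∀ i ∈ I, g i ∈ Stab cs x := fun i hi => by
    rw [← hcl]; exact Subgroup.subset_closure ⟨i, hi, rfl⟩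
  have hab : ∀ u ∈ Stab cs x, ∀ v ∈ Stab cs x, u * v = v * u := by
    rw [← hcl]
    intro u hu v hv
    have h1 : Subgroup.closure (g '' I) ≤ Subgroup.centralizer (g '' (I : Set B₀)) := by
      rw [Subgroup.closure_le]
      rintro _ ⟨i, hi, rfl⟩
      rw [SetLike.mem_coe, Subgroup.mem_centralizer_iff]
      rintro _ ⟨j, hj, rfl⟩
      exact hcomm j hj i hi
    have h2 : Subgroup.closure (g '' I) ≤ Subgroup.centralizer ({u} : Set W) := by
      rw [Subgroup.closure_le]
      rintro _ ⟨i, hi, rfl⟩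
      rw [SetLike.mem_coe, Subgroup.mem_centralizer_iff]
      rintro _ rfl
      exact (Subgroup.mem_centralizer_iff.1 (h1 hu) _ ⟨i, hi, rfl⟩).symm
    exact Subgroup.mem_centralizer_iff.1 (h2 hv) u rfl
  have hgram : ∀ a b, x (al a) = 0 → x (al b) = 0 → a ≠ b → gram M a b = 0 :=
    fun a b ha hb hne => gram_zero_of_comm hne
      (hab _ (simple_mem_Stab ha) _ (simple_mem_Stab hb))
  have hsimp : ∀ a b, x (al a) = 0 → x (al b) = 0 →
      rep cs (cs.simple a) (al b) = if b = a then - al b else al b := by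
    intro a b ha hb
    rw [rep_simple]
    split_ifs with h
    · subst h; exact refl_al_self _
    · rw [refl_apply, phi_al, hgram a b ha hb (Ne.symm h), zero_smul, sub_zero]
  have hsign : ∀ u ∈ Stab cs x, ∀ b, x (al b) = 0 →
      rep cs u (al b) = al b ∨ rep cs u (al b) = - al b := by
    intro u hu b hb
    rw [hSt] at hu
    induction hu using Subgroup.closure_induction with
    | mem y hy =>
      obtain ⟨a, ha, rfl⟩ := hy
      rw [hsimp a b ha hb]
      split_ifs <;> simp
    | one => left; rw [rep_one_apply]
    | mul u v _ _ h1 h2 =>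
      rw [rep_mul_apply]
      rcases h2 with h2 | h2 <;> rcases h1 with h1 | h1 <;> simp [h1, h2]
    | inv u _ h =>
      rcases h with h | h
      · left; nth_rewrite 1 [← h]; rw [rep_inv_apply]
      · right
        have : al b = rep cs u (- al b) := by rw [map_neg, h, neg_neg]
        nth_rewrite 1 [this]; rw [rep_inv_apply]
  have hdmul : ∀ u ∈ Stab cs x, ∀ v ∈ Stab cs x, dv cs x (u * v) = dv cs x u + dv cs x v := by
    intro u hu v hv
    funext b
    simp only [dv, Pi.add_apply]
    by_cases hb : x (al b) = 0
    · simp only [hb, true_and, rep_mul_apply]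
      have n1 := al_ne_neg b
      have e2 : (0 : ZMod 2) = 1 + 1 := by decide
      rcases hsign u hu b hb with h1 | h1 <;> rcases hsign v hv b hb with h2 | h2 <;>
        simp [h1, h2, n1, n1.symm, e2]
    · simp [hb]
  have hdone : dv cs x 1 = 0 := by
    funext b
    simp [dv, rep_one_apply, al_ne_neg]
  have hdinv : ∀ u ∈ Stab cs x, dv cs x u⁻¹ = - dv cs x u := by
    intro u hu
    have := hdmul _ (inv_mem hu) _ hu
    rw [inv_mul_cancel, hdone] at this
    exact eq_neg_of_add_eq_zero_left this.symm
  have hdzero : ∀ u ∈ Stab cs x, dv cs x u = 0 → u = 1 := by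
    intro u hu h
    by_contra hne1
    obtain ⟨s, hs⟩ := cs.exists_rightDescent_of_ne_one hne1
    have h0 := descent_zero hx hu hs
    have h2 := rep_neg cs hs
    rcases hsign u hu s h0 with h1 | h1
    · rw [h1] at h2
      exact (root_al cs s).not_both (pos_al s) h2
    · have := congrFun h s
      simp [dv, h0, h1] at this
  have hdinj : ∀ u ∈ Stab cs x, ∀ v ∈ Stab cs x, dv cs x u = dv cs x v → u = v := by
    intro u hu v hv h
    have := hdzero (u⁻¹ * v) (mul_mem (inv_mem hu) hv) (by
      rw [hdmul _ (inv_mem hu) _ hv, hdinv u hu, h, neg_add_cancel])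
    exact inv_mul_eq_one.1 this
  have hdsimple : ∀ a, x (al a) = 0 → dv cs x (cs.simple a) = Pi.single a 1 := by
    intro a ha
    funext b
    by_cases hb : x (al b) = 0
    · simp only [dv, hb, hsimp a b ha hb, true_and]
      by_cases hba : b = a
      · subst hba; simp
      · simp [hba, al_ne_neg]
    · have hba : b ≠ a := by rintro rfl; exact hb ha
      simp [dv, hb, hba]
  have hspan : ∀ u ∈ Stab cs x,
      dv cs x u ∈ Submodule.span (ZMod 2) ((I.image (fun i => dv cs x (g i)) : Finset _) : Set (B → ZMod 2)) := by
    intro u hu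
    rw [← hcl] at hu
    induction hu using Subgroup.closure_induction with
    | mem y hy =>
      obtain ⟨i, hi, rfl⟩ := hy
      apply Submodule.subset_span
      rw [Finset.coe_image]
      exact ⟨i, hi, rfl⟩
    | one => rw [hdone]; exact zero_mem _
    | mul u v hu hv h1 h2 =>
      rw [hcl] at hu hv
      rw [hdmul u hu v hv]; exact add_mem h1 h2
    | inv u hu h =>
      rw [hcl] at hu
      rw [hdinv u hu]; exact neg_mem h
  have hT : ∀ T : Finset B, (∀ j ∈ T, x (al j) = 0) → T.card ≤ 3 := by
    intro T hT
    have hli : LinearIndependent (ZMod 2) (fun j : T => (Pi.single (j : B) 1 : B → ZMod 2)) :=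
      (Pi.linearIndependent_single_one B (ZMod 2)).comp _ Subtype.val_injective
    have h1 := finrank_span_eq_card hli
    have h2 : Submodule.span (ZMod 2) (Set.range (fun j : T => (Pi.single (j : B) 1 : B → ZMod 2)))
        ≤ Submodule.span (ZMod 2) ((I.image (fun i => dv cs x (g i)) : Finset _) : Set (B → ZMod 2)) := by
      rw [Submodule.span_le]
      rintro _ ⟨j, rfl⟩
      simp only
      rw [← hdsimple j (hT j j.2)]
      exact hspan _ (simple_mem_Stab (hT j j.2))
    have h3 := Submodule.finrank_mono h2
    have h4 := finrank_span_finset_le_card (R := ZMod 2) (I.image (fun i => dv cs x (g i)))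
    have h5 : (I.image (fun i => dv cs x (g i))).card ≤ I.card := Finset.card_image_le
    rw [h1, Fintype.card_coe] at h3
    exact (h3.trans h4).trans (h5.trans hcard)
  have hJ : {j | x (al j) = 0}.Finite := by
    by_contra hinf
    obtain ⟨T, hT1, hT2⟩ := Set.Infinite.exists_subset_card_eq hinf 4
    have := hT T (fun j hj => hT1 hj)
    omega
  set J := hJ.toFinset with hJd
  have hJmem : ∀ j, j ∈ J ↔ x (al j) = 0 := fun j => by simp [hJd]
  have hJ3 : J.card ≤ 3 := hT J fun j hj => (hJmem j).1 hj
  have hpar : ∀ u ∈ Stab cs x, cs.lengthParity u = Multiplicative.ofAdd (∑ j ∈ J, dv cs x u j) := by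
    intro u hu
    rw [hSt] at hu
    induction hu using Subgroup.closure_induction with
    | mem y hy =>
      obtain ⟨a, ha, rfl⟩ := hy
      rw [hdsimple a ha, lengthParity_simple]
      congr 1
      simp [Pi.single_apply, (hJmem a).2 ha]
    | one => simp [hdone]
    | mul u v hu hv h1 h2 =>
      rw [← hSt] at hu hv
      rw [hdmul u hu v hv, map_mul, h1, h2, ← ofAdd_add, ← Finset.sum_add_distrib]
      rfl
    | inv u hu h =>
      rw [← hSt] at hu
      rw [hdinv u hu, map_inv, h, ← ofAdd_neg, ← Finset.sum_neg_distrib]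
      rfl
  have hodd1 : ∀ i ∈ I, cs.lengthParity (g i) ≠ 1 := by
    intro i hi h
    have hall : Stab cs x ≤ cs.lengthParity.ker := by
      rw [← hcl, Subgroup.closure_le]
      rintro _ ⟨j, hj, rfl⟩
      rw [SetLike.mem_coe, MonoidHom.mem_ker, ← h]
      exact (isConj_iff_eq.1 (cs.lengthParity.map_isConj (hconj j hj i hi)))
    have hempty : {s | x (al s) = 0} = ∅ := by
      rw [Set.eq_empty_iff_forall_notMem]
      intro s hs
      have := hall (simple_mem_Stab (cs := cs) hs)
      rw [MonoidHom.mem_ker, lengthParity_simple] at this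
      revert this
      decide
    rw [hempty, Set.image_empty, Subgroup.closure_empty] at hSt
    have := hgS i hi
    rw [hSt, Subgroup.mem_bot] at this
    exact hone i hi this
  set Su : B₀ → Finset B := fun i => J.filter (fun j => rep cs (g i) (al j) = - al j) with hSu
  have hdS : ∀ i j, dv cs x (g i) j = if j ∈ Su i then 1 else 0 := by
    intro i j
    simp only [dv, hSu, Finset.mem_filter, hJmem]
  have hSub : ∀ i, Su i ⊆ J := fun i => Finset.filter_subset _ _
  have hodd : ∀ i ∈ I, (Su i).card = 1 ∨ (Su i).card = 3 := by
    intro i hi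
    have h1 := hodd1 i hi
    rw [hpar _ (hgS i hi)] at h1
    have h2 : ∑ j ∈ J, dv cs x (g i) j = ((Su i).card : ZMod 2) := by
      simp only [hdS]
      rw [Finset.sum_boole, Finset.filter_mem_eq_inter, Finset.inter_eq_right.2 (hSub i)]
    rw [h2] at h1
    have h3 : (Su i).card ≤ 3 := (Finset.card_le_card (hSub i)).trans hJ3
    have h4 : (Su i).card ≠ 0 := by
      intro h; rw [h] at h1; exact h1 rfl
    have h5 : (Su i).card ≠ 2 := by
      intro h; rw [h] at h1; exact h1 rfl
    omega
  have hsingle : ∀ i ∈ I, (Su i).card = 1 → ∃ b, g i = cs.simple b := by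
    intro i hi h
    obtain ⟨b, hb⟩ := Finset.card_eq_one.1 h
    have hbJ : x (al b) = 0 := (hJmem b).1 (hSub i (by rw [hb]; simp))
    refine ⟨b, hdinj _ (hgS i hi) _ (simple_mem_Stab hbJ) ?_⟩
    rw [hdsimple b hbJ]
    funext j
    rw [hdS, hb]
    simp [Pi.single_apply]
  by_cases hex : ∃ i ∈ I, (Su i).card = 1
  · obtain ⟨i, hi, h1⟩ := hex
    obtain ⟨b, hb⟩ := hsingle i hi h1
    intro j hj
    rcases hodd j hj with h | h
    · exact hsingle j hj h
    · exfalso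
      obtain ⟨p, hp, q, hq, hpq⟩ := Finset.one_lt_card.1 (by omega : 1 < (Su j).card)
      refine not_conj (cs := cs) (s := b) hpq (hb ▸ hconj i hi j hj) ?_ ?_
      · exact (Finset.mem_filter.1 hp).2
      · exact (Finset.mem_filter.1 hq).2
  · exfalso
    push Not at hex
    have hall : ∀ i ∈ I, Su i = J := by
      intro i hi
      have h3 := (hodd i hi).resolve_left (hex i hi)
      exact Finset.eq_of_subset_of_card_le (hSub i) (by omega)
    obtain ⟨i, hi⟩ := hne
    have hJ1 : 1 < J.card := by
      rw [← hall i hi]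
      have h3 := (hodd i hi).resolve_left (hex i hi)
      omega
    obtain ⟨p, hp, q, hq, hpq⟩ := Finset.one_lt_card.1 hJ1
    have heq : ∀ u ∈ Stab cs x, dv cs x u p = dv cs x u q := by
      intro u hu
      rw [← hcl] at hu
      induction hu using Subgroup.closure_induction with
      | mem y hy =>
        obtain ⟨i, hi, rfl⟩ := hy
        rw [hdS, hdS, hall i hi, if_pos hp, if_pos hq]
      | one => rw [hdone]; rfl
      | mul u v hu hv h1 h2 =>
        rw [hcl] at hu hv
        rw [hdmul u hu v hv, Pi.add_apply, Pi.add_apply, h1, h2]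
      | inv u hu h =>
        rw [hcl] at hu
        rw [hdinv u hu, Pi.neg_apply, Pi.neg_apply, h]
    have hp0 := (hJmem p).1 hp
    have := heq _ (simple_mem_Stab hp0)
    rw [hdsimple p hp0] at this
    simp [hpq.symm] at this

end CoxGeom


/-- Let `I ⊆ S` be a nonempty set of at most three generators that pairwise commute and are
pairwise conjugate in `W`, and suppose that the standard parabolic subgroup `W_I` is the
intersection of finitely many maximal finite subgroups of `W`.  Then for every Coxeter system
`(W',S')` and every group isomorphism `f : W → W'`, there is `w ∈ W'` with
`f(I) ⊆ w S' w⁻¹`; in particular every element of `f(I)` is a reflection of `(W',S')`. -/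
theorem stmt_13 {B W : Type*} [Group W] {M : CoxeterMatrix B} (cs : CoxeterSystem M W)
    (I : Finset B) (hne : I.Nonempty) (hcard : I.card ≤ 3)
    (hcomm : ∀ x ∈ I, ∀ y ∈ I, cs.simple x * cs.simple y = cs.simple y * cs.simple x)
    (hconj : ∀ x ∈ I, ∀ y ∈ I, IsConj (cs.simple x) (cs.simple y))
    (hint : ∃ (n : ℕ) (_ : 0 < n) (Hs : Fin n → Subgroup W),
      (∀ i, Finite ↥(Hs i) ∧ ∀ K : Subgroup W, Finite ↥K → Hs i ≤ K → K = Hs i) ∧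
      Subgroup.closure (cs.simple '' ↑I) = ⨅ i, Hs i) :
    ∀ (B' W' : Type*) [Group W'] (M' : CoxeterMatrix B') (cs' : CoxeterSystem M' W')
      (f : W ≃* W'), ∃ w : W',
        ∀ x ∈ I, ∃ b' : B', f (cs.simple x) = w * cs'.simple b' * w⁻¹ := by

  intro B' W' _ M' cs' f
  obtain ⟨n, hn, Hs, hmax, hI⟩ := hint
  let c2 : CoxeterSystem M' W := cs'.map f.symm
  obtain ⟨x, hx, hxs⟩ := CoxGeom.exists_inner_of_iInf (cs := c2) hn Hs hmax
  obtain ⟨w, hw⟩ := CoxGeom.exists_dominant (cs := c2) _ x hx rfl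
  have hcl : Subgroup.closure ((fun i => w⁻¹ * cs.simple i * w) '' (I : Set B)) =
      CoxGeom.Stab c2 (x ∘ₗ CoxGeom.rep c2 w) := by
    have h1 : (fun i => w⁻¹ * cs.simple i * w) '' (I : Set B) =
        (MulAut.conj w⁻¹).toMonoidHom '' (cs.simple '' (I : Set B)) := by
      rw [Set.image_image]
      simp [MulAut.conj_apply]
    rw [h1, ← MonoidHom.map_closure, hI, ← hxs]
    ext u
    rw [CoxGeom.mem_Stab_comp, Subgroup.mem_map]
    constructor
    · rintro ⟨v, hv, rfl⟩
      convert hv using 1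
      simp [MulAut.conj_apply, mul_assoc]
    · intro hu
      exact ⟨_, hu, by simp [MulAut.conj_apply, mul_assoc]⟩
  have key := CoxGeom.core (cs := c2) (x ∘ₗ CoxGeom.rep c2 w) hw I hne hcard
    (fun i => w⁻¹ * cs.simple i * w)
    (by
      intro i hi j hj
      have h := hcomm i hi j hj
      calc w⁻¹ * cs.simple i * w * (w⁻¹ * cs.simple j * w)
          = w⁻¹ * (cs.simple i * cs.simple j) * w := by group
        _ = w⁻¹ * (cs.simple j * cs.simple i) * w := by rw [h]
        _ = w⁻¹ * cs.simple j * w * (w⁻¹ * cs.simple i * w) := by group)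
    (by
      intro i hi h
      have h2 : cs.simple i = 1 := by
        have : cs.simple i = w * (w⁻¹ * cs.simple i * w) * w⁻¹ := by group
        rw [this, h]; simp
      have := cs.length_simple i
      rw [h2, cs.length_one] at this
      omega)
    (by
      intro i hi j hj
      have hc : ∀ y : W, IsConj y (w⁻¹ * y * w) := fun y =>
        isConj_iff.2 ⟨w⁻¹, by simp⟩
      exact ((hc _).symm.trans (hconj i hi j hj)).trans (hc _))
    hcl
  refine ⟨f w, fun i hi => ?_⟩
  obtain ⟨b, hb⟩ := key i hi
  refine ⟨b, ?_⟩
  have h1 : cs.simple i = w * c2.simple b * w⁻¹ := by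
    rw [← hb]; group
  have h2 : c2.simple b = f.symm (cs'.simple b) := by
    simp [c2]
  rw [h1, h2]
  simp
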